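/- arXiv:1312.5160 — 6 statements merged into one kernel-verified Lean document; each statement's English description precedes it below -/
import Mathlib

section
/- Let p be an odd prime and let e_p ∈ ℚ_p denote the sum of the convergent series ∑_{n=0}^∞ p^n/n! in ℚ_p. Then the polynomial X^p − e_p is irreducible over ℚ_p; in particular, there is no x ∈ ℚ_p with x^p = e_p. -/
open Filter Polynomial

/-- For odd `p`, the terms `pⁿ/n!` with `n ≥ 2` are divisible by `p²` in `ℤ_p`. -/
lemma Padic.norm_pow_div_factorial_le {p : ℕ} [hp : Fact p.Prime] (hp2 : p ≠ 2) {n : ℕ}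
    (hn : 2 ≤ n) : ‖(p : ℚ_[p]) ^ n / (n.factorial : ℚ_[p])‖ ≤ (p : ℝ) ^ (-2 : ℤ) := by
  have hval : padicValNat p n.factorial + 2 ≤ n := by
    have h := sub_one_mul_padicValNat_factorial_lt_of_ne_zero p (n := n) (by omega)
    have h2 : 2 ≤ p - 1 := by have := hp.out.two_le; omega
    have := Nat.mul_le_mul_right (padicValNat p n.factorial) h2
    omega
  have hp1 : (1 : ℝ) ≤ p := mod_cast hp.out.one_le
  have hp0 : (p : ℝ) ≠ 0 := by positivity
  rw [norm_div, norm_pow, Padic.norm_p,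
    Padic.norm_eq_zpow_neg_valuation (mod_cast n.factorial_ne_zero), Padic.valuation_natCast,
    inv_pow, ← zpow_natCast, ← zpow_neg, ← zpow_sub₀ hp0]
  exact zpow_le_zpow_right₀ hp1 (by omega)

/-- For odd `p`, the sum of `∑ pⁿ/n!` is congruent to `1 + p` modulo `p²`. -/
lemma Padic.norm_exp_p_sub_one_add_p_le {p : ℕ} [hp : Fact p.Prime] (hp2 : p ≠ 2) {e : ℚ_[p]}
    (he : Tendsto
      (fun N : ℕ => ∑ n ∈ Finset.range (N + 1),
        ((p ^ n / n.factorial : ℚ) : ℚ_[p])) atTop (nhds e)) :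
    ‖e - (1 + p)‖ ≤ (p : ℝ) ^ (-2 : ℤ) := by
  refine le_of_tendsto (he.sub_const (1 + (p : ℚ_[p]))).norm ?_
  filter_upwards [eventually_ge_atTop 1] with N hN
  obtain ⟨M, rfl⟩ := Nat.exists_eq_add_of_le' hN
  rw [Finset.sum_range_succ', Finset.sum_range_succ']
  have : ∀ a b : ℚ_[p], a + b + 1 - (1 + b) = a := fun a b => by ring
  simp only [zero_add, pow_one, pow_zero, Nat.factorial_zero, Nat.factorial_one, Nat.cast_one,
    div_one, Rat.cast_one, Rat.cast_natCast, this]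
  refine IsUltrametricDist.norm_sum_le_of_forall_le_of_nonneg (by positivity) fun n _ => ?_
  push_cast
  exact_mod_cast norm_pow_div_factorial_le hp2 (by omega : 2 ≤ n + 1 + 1)

/-- A `p`-th power in `ℤ_p` is never congruent to `1 + p` modulo `p²`. -/
lemma PadicInt.not_sq_dvd_pow_sub_one_add_p {p : ℕ} [hp : Fact p.Prime] (x : ℤ_[p]) :
    ¬ (p : ℤ_[p]) ^ 2 ∣ x ^ p - (1 + p) := by
  intro h
  have hdvd : (p : ℤ_[p]) ∣ x - 1 := by
    rw [← Ideal.mem_span_singleton, ← maximalIdeal_eq_span_p, ← ker_toZMod, RingHom.mem_ker]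
    have h0 := map_dvd (toZMod (p := p)) ((dvd_pow_self _ two_ne_zero).trans h)
    simpa [ZMod.pow_card] using h0
  have hpow : (p : ℤ_[p]) ^ 2 ∣ x ^ p - 1 := by
    simpa using dvd_sub_pow_of_dvd_sub hdvd 1
  have hp_dvd : (p : ℤ_[p]) ^ 2 ∣ p := by
    simpa using dvd_sub hpow h
  have := (pow_dvd_pow_iff prime_p.ne_zero prime_p.not_isUnit (n := 2) (m := 1)).1
    (by simpa using hp_dvd)
  omega

/-- For an odd prime `p`, if `e ∈ ℚ_p` is the sum of the convergent series `∑ pⁿ/n!`,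
then `X ^ p - e` is irreducible over `ℚ_p`; in particular `e` has no `p`-th root in `ℚ_p`. -/
theorem X_pow_p_sub_exp_p_irreducible (p : ℕ) [Fact p.Prime] (hp : p ≠ 2) (e : ℚ_[p])
    (he : Tendsto
      (fun N : ℕ => ∑ n ∈ Finset.range (N + 1),
        ((p ^ n / n.factorial : ℚ) : ℚ_[p])) atTop (nhds e)) :
    Irreducible ((X : ℚ_[p][X]) ^ p - C e) ∧ ∀ x : ℚ_[p], x ^ p ≠ e := by
  have hprime : p.Prime := Fact.out
  suffices hroot : ∀ x : ℚ_[p], x ^ p ≠ e from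
    ⟨X_pow_sub_C_irreducible_of_prime hprime hroot, hroot⟩
  rintro x rfl
  have hclose := Padic.norm_exp_p_sub_one_add_p_le hp he
  have hx : ‖x‖ ≤ 1 := by
    have hle : ‖x ^ p‖ ≤ 1 := by
      rw [← sub_add_cancel (x ^ p) (1 + (p : ℚ_[p]))]
      refine (Padic.nonarchimedean _ _).trans (max_le (hclose.trans ?_) ?_)
      · exact zpow_le_one_of_nonpos₀ (mod_cast hprime.one_le) (by norm_num)
      · have h := PadicInt.norm_le_one (1 + (p : ℤ_[p]))
        rw [PadicInt.norm_def] at h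
        push_cast at h
        exact h
    rwa [norm_pow, pow_le_one_iff_of_nonneg (norm_nonneg x) hprime.ne_zero] at hle
  refine PadicInt.not_sq_dvd_pow_sub_one_add_p (⟨x, hx⟩ : ℤ_[p]) ?_
  rw [← Ideal.mem_span_singleton, ← PadicInt.norm_le_pow_iff_mem_span_pow, PadicInt.norm_def]
  exact_mod_cast hclose
end

section
/- (Leibniz–Kontsevich integral formula for multiple zeta values.) Let m ≥ 1 and let n₁, …, n_m be positive integers with n_m ≥ 2, and set n := n₁ + ⋯ + n_m. Define ε = (ε₁, …, ε_n) ∈ {0,1}^n by ε_i = 1 precisely when i ∈ {1, n₁+1, n₁+n₂+1, …, n₁+⋯+n_{m−1}+1}, and ε_i = 0 otherwise. Then ∑_{0 < k₁ < k₂ < ⋯ < k_m} 1/(k₁^{n₁} ⋯ k_m^{n_m}) = (−1)^m ∫_{Δ⁰_n} ∏_{i=1}^n (t_i − ε_i)^{−1} dt₁⋯dt_n, where Δ⁰_n := {(t₁,…,t_n) ∈ ℝ^n : 0 < t₁ < t₂ < ⋯ < t_n < 1} and the integral is a Lebesgue integral over Δ⁰_n ⊂ ℝ^n, which is absolutely convergent;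 the left-hand side is the multiple zeta value ζ(n₁,…,n_m), a convergent sum over all strictly increasing m-tuples of positive integers. -/
open MeasureTheory
open scoped ENNReal

theorem ENNReal.tsum_tsum_add_succ (F : ℕ → ℕ → ℝ≥0∞) :
    ∑' k, ∑' l, F k (k + l + 1) = ∑' K, ∑ k ∈ Finset.range K, F k K := by
  have h1 : ∀ K, ∑ k ∈ Finset.range K, F k K = ∑' k, if k < K then F k K else 0 := by
    intro K
    rw [tsum_eq_sum (s := Finset.range K)]
    · exact Finset.sum_congr rfl fun k hk => by simp [Finset.mem_range.1 hk]
    · intro k hk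
      simp_all
  simp_rw [h1]
  rw [ENNReal.tsum_comm (f := fun K k => if k < K then F k K else 0)]
  refine tsum_congr fun k => ?_
  have hinj : Function.Injective fun l : ℕ => k + l + 1 := fun a b h => by
    simpa using h
  rw [← hinj.tsum_eq (f := fun K => if k < K then F k K else 0)]
  · exact tsum_congr fun l => by rw [if_pos (by omega)]
  · intro K hK
    have : k < K := by
      by_contra h
      simp [h] at hK
    exact ⟨K - k - 1, by simp only; omega⟩

theorem lintegral_Ioo_ofReal_pow {x : ℝ} (hx : 0 ≤ x) (n : ℕ) :
    ∫⁻ y in Set.Ioo 0 x, ENNReal.ofReal y ^ n =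
      ENNReal.ofReal x ^ (n + 1) * ((n + 1 : ℕ) : ℝ≥0∞)⁻¹ := by
  have h1 : ∫⁻ y in Set.Ioo 0 x, ENNReal.ofReal y ^ n =
      ∫⁻ y in Set.Ioo 0 x, ENNReal.ofReal (y ^ n) :=
    setLIntegral_congr_fun measurableSet_Ioo fun y hy => (ENNReal.ofReal_pow hy.1.le n).symm
  rw [h1, ← ofReal_integral_eq_lintegral_ofReal]
  · rw [← integral_Ioc_eq_integral_Ioo, ← intervalIntegral.integral_of_le hx, integral_pow,
      ← ENNReal.ofReal_pow hx, ← ENNReal.ofReal_natCast, ← ENNReal.ofReal_inv_of_pos (by positivity),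
      ← ENNReal.ofReal_mul (by positivity)]
    simp [div_eq_mul_inv]
  · exact ((continuous_pow n).integrableOn_Icc (a := 0) (b := x)).mono_set Set.Ioo_subset_Icc_self
  · filter_upwards [ae_restrict_mem measurableSet_Ioo] with y hy
    exact pow_nonneg hy.1.le n

theorem Fin.strictMono_snoc_iff {α : Type*} [Preorder α] {k : ℕ} (t : Fin (k + 1) → α) (x : α) :
    StrictMono (Fin.snoc t x : Fin (k + 2) → α) ↔ StrictMono t ∧ t (Fin.last k) < x := by
  simp only [Fin.strictMono_iff_lt_succ]
  constructor
  · intro h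
    refine ⟨fun i => ?_, ?_⟩
    · have := h i.castSucc
      rwa [Fin.snoc_castSucc, Fin.succ_castSucc, Fin.snoc_castSucc] at this
    · have := h (Fin.last k)
      rwa [Fin.snoc_castSucc, Fin.succ_last, Fin.snoc_last] at this
  · rintro ⟨h1, h2⟩ i
    induction i using Fin.lastCases with
    | last => rwa [Fin.snoc_castSucc, Fin.succ_last, Fin.snoc_last]
    | cast i =>
      rw [Fin.snoc_castSucc, Fin.succ_castSucc, Fin.snoc_castSucc]
      exact h1 i

section IteratedIntegral

variable {α : Type*} [MeasurableSpace α] [LinearOrder α]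

/-- The iterated integrals of the weights `f 0, f 1, …` over
`t 0 < t 1 < ⋯ < t (k - 1) < x`. -/
noncomputable def iterLIntegral (μ : Measure α) (f : ℕ → α → ℝ≥0∞) : ℕ → α → ℝ≥0∞
  | 0, _ => 1
  | k + 1, x => ∫⁻ y in Set.Iio x, iterLIntegral μ f k y * f k y ∂μ

variable [TopologicalSpace α] [SecondCountableTopology α] [OrderClosedTopology α]
  [OpensMeasurableSpace α]

theorem measurableSet_strictMono (k : ℕ) : MeasurableSet {t : Fin k → α | StrictMono t} := by
  have : {t : Fin k → α | StrictMono t} = ⋂ i, ⋂ j, ⋂ (_ : i < j), {t | t i < t j} := by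
    ext t
    simp [StrictMono]
  rw [this]
  exact MeasurableSet.iInter fun i => MeasurableSet.iInter fun j => MeasurableSet.iInter fun _ =>
    measurableSet_lt (measurable_pi_apply i) (measurable_pi_apply j)

theorem setLIntegral_strictMono_prod (μ : Measure α) [SigmaFinite μ] {f : ℕ → α → ℝ≥0∞}
    (hf : ∀ i, Measurable (f i)) (k : ℕ) {g : α → ℝ≥0∞} (hg : Measurable g) :
    ∫⁻ t in {t : Fin (k + 1) → α | StrictMono t}, (∏ i : Fin (k + 1), f i (t i)) * g (t (Fin.last k))
        ∂(Measure.pi fun _ => μ) = ∫⁻ x, iterLIntegral μ f k x * f k x * g x ∂μ := by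
  induction k generalizing g with
  | zero =>
    have : {t : Fin (0 + 1) → α | StrictMono t} = Set.univ := by
      ext t
      simp [Fin.strictMono_iff_lt_succ]
    rw [this, Measure.restrict_univ,
      ← ((measurePreserving_piUnique fun _ : Fin 1 => μ).symm).lintegral_comp_emb
        (MeasurableEquiv.measurableEmbedding _)]
    simp [iterLIntegral, MeasurableEquiv.piUnique]
  | succ k ih =>
    have hm (j : ℕ) {g : α → ℝ≥0∞} (hg : Measurable g) :
        Measurable ({t : Fin (j + 1) → α | StrictMono t}.indicator
          fun t => (∏ i : Fin (j + 1), f i (t i)) * g (t (Fin.last j))) := by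
      refine Measurable.indicator ?_ (measurableSet_strictMono _)
      refine Measurable.mul ?_ (hg.comp (measurable_pi_apply _))
      exact Finset.measurable_prod _ fun i _ => (hf i).comp (measurable_pi_apply i)
    rw [← lintegral_indicator (measurableSet_strictMono _),
      ← ((measurePreserving_piFinSuccAbove (fun _ : Fin (k + 2) => μ)
        (Fin.last (k + 1))).symm).lintegral_comp_emb (MeasurableEquiv.measurableEmbedding _),
      lintegral_prod]
    swap
    · exact ((hm (k + 1) hg).comp (MeasurableEquiv.measurable _)).aemeasurable
    refine lintegral_congr fun x => ?_
    have key : ∀ t : Fin (k + 1) → α, {t : Fin (k + 2) → α | StrictMono t}.indicator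
          (fun t => (∏ i : Fin (k + 2), f i (t i)) * g (t (Fin.last (k + 1))))
          ((MeasurableEquiv.piFinSuccAbove (fun _ : Fin (k + 2) => α) (Fin.last (k + 1))).symm
            (x, t)) =
        (f (k + 1) x * g x) * {t : Fin (k + 1) → α | StrictMono t}.indicator
          (fun t => (∏ i : Fin (k + 1), f i (t i)) * (Set.Iio x).indicator 1 (t (Fin.last k))) t := by
      intro t
      have h1 : (MeasurableEquiv.piFinSuccAbove (fun _ : Fin (k + 2) => α)
          (Fin.last (k + 1))).symm (x, t) = (Fin.snoc t x : Fin (k + 2) → α) := by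
        simp [MeasurableEquiv.piFinSuccAbove, Fin.insertNthEquiv]
      rw [h1]
      simp only [Set.indicator_apply, Set.mem_ofPred_eq, Fin.strictMono_snoc_iff, Set.mem_Iio,
        Fin.prod_univ_castSucc (n := k + 1), Fin.snoc_castSucc, Fin.snoc_last, Fin.val_castSucc,
        Fin.val_last, Pi.one_apply]
      by_cases h2 : StrictMono t <;> by_cases h3 : t (Fin.last k) < x <;> simp [h2, h3]
      ring
    have hI : Measurable ((Set.Iio x).indicator (1 : α → ℝ≥0∞)) :=
      measurable_one.indicator measurableSet_Iio
    simp_rw [key]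
    rw [lintegral_const_mul _ (hm k hI), lintegral_indicator (measurableSet_strictMono _), ih hI,
      iterLIntegral, ← lintegral_indicator measurableSet_Iio, mul_comm, ← mul_assoc]
    congr 3
    ext y
    by_cases hy : y < x <;> simp [hy]

end IteratedIntegral

/-- The weight `|t - 1|⁻¹` (at the positions satisfying `e`) or `|t|⁻¹` (at the other ones) on the
unit interval. -/
noncomputable def simplexWeight (e : ℕ → Prop) [DecidablePred e] (p : ℕ) : ℝ → ℝ≥0∞ :=
  (Set.Ioo (0 : ℝ) 1).indicator fun t => ENNReal.ofReal |t - if e p then 1 else 0|⁻¹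

theorem measurable_simplexWeight (e : ℕ → Prop) [DecidablePred e] (p : ℕ) :
    Measurable (simplexWeight e p) := by
  refine Measurable.indicator ?_ measurableSet_Ioo
  fun_prop

/-- The coefficients of the power series expansion of the iterated integrals of
`simplexWeight`. -/
noncomputable def simplexCoeff (e : ℕ → Prop) [DecidablePred e] : ℕ → ℕ → ℝ≥0∞
  | 0, k => if k = 0 then 1 else 0
  | p + 1, k => (if e p then ∑ l ∈ Finset.range k, simplexCoeff e p l else simplexCoeff e p k) *
      (k : ℝ≥0∞)⁻¹

theorem simplexCoeff_succ_zero (e : ℕ → Prop) [DecidablePred e] (he : e 0) (p : ℕ) :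
    simplexCoeff e (p + 1) 0 = 0 := by
  induction p with
  | zero => simp [simplexCoeff, he]
  | succ p ih => rw [simplexCoeff, ih]; simp

theorem iterLIntegral_simplexWeight (e : ℕ → Prop) [DecidablePred e] (he : e 0) (p : ℕ) {x : ℝ}
    (hx0 : 0 ≤ x) (hx1 : x ≤ 1) :
    iterLIntegral volume (simplexWeight e) p x =
      ∑' k, simplexCoeff e p k * ENNReal.ofReal x ^ k := by
  induction p generalizing x with
  | zero =>
    rw [tsum_eq_single 0 fun k hk => by simp [simplexCoeff, hk]]
    simp [iterLIntegral, simplexCoeff]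
  | succ p ih =>
    have h1 : iterLIntegral volume (simplexWeight e) (p + 1) x =
        ∫⁻ y in Set.Ioo 0 x, (∑' k, simplexCoeff e p k * ENNReal.ofReal y ^ k) *
          ENNReal.ofReal |y - if e p then 1 else 0|⁻¹ := by
      rw [iterLIntegral, ← lintegral_indicator measurableSet_Iio,
        ← lintegral_indicator measurableSet_Ioo]
      refine lintegral_congr fun y => ?_
      by_cases hy : y ∈ Set.Ioo 0 x
      · rw [Set.indicator_of_mem hy, Set.indicator_of_mem (show y ∈ Set.Iio x from hy.2),
          simplexWeight,
          Set.indicator_of_mem (show y ∈ Set.Ioo (0 : ℝ) 1 from ⟨hy.1, hy.2.trans_le hx1⟩),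
          ih hy.1.le (hy.2.le.trans hx1)]
      · rw [Set.indicator_of_notMem hy, Set.indicator_apply_eq_zero]
        intro hyx
        rw [simplexWeight, Set.indicator_of_notMem fun h => hy ⟨h.1, hyx⟩, mul_zero]
    rw [h1]
    by_cases hp : e p
    · have h2 : ∀ y ∈ Set.Ioo 0 x, (∑' k, simplexCoeff e p k * ENNReal.ofReal y ^ k) *
          ENNReal.ofReal |y - if e p then 1 else 0|⁻¹ =
          ∑' k, ∑' l, simplexCoeff e p k * ENNReal.ofReal y ^ (k + l) := by
        intro y hy
        have hy1 : y < 1 := hy.2.trans_le hx1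
        have h3 : ENNReal.ofReal |y - if e p then 1 else 0|⁻¹ = ∑' l, ENNReal.ofReal y ^ l := by
          rw [if_pos hp, abs_sub_comm, abs_of_pos (by linarith), ENNReal.tsum_geometric,
            ENNReal.ofReal_inv_of_pos (by linarith), ENNReal.ofReal_sub _ hy.1.le,
            ENNReal.ofReal_one]
        rw [h3, ← ENNReal.tsum_mul_right]
        refine tsum_congr fun k => ?_
        rw [← ENNReal.tsum_mul_left]
        exact tsum_congr fun l => by rw [pow_add, mul_assoc]
      rw [setLIntegral_congr_fun measurableSet_Ioo h2, lintegral_tsum fun k => by fun_prop]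
      have h4 : ∀ k, ∫⁻ y in Set.Ioo 0 x, ∑' l, simplexCoeff e p k * ENNReal.ofReal y ^ (k + l) =
          ∑' l, simplexCoeff e p k * (ENNReal.ofReal x ^ (k + l + 1) *
            ((k + l + 1 : ℕ) : ℝ≥0∞)⁻¹) := by
        intro k
        rw [lintegral_tsum fun l => by fun_prop]
        refine tsum_congr fun l => ?_
        rw [lintegral_const_mul _ (by fun_prop), lintegral_Ioo_ofReal_pow hx0]
      simp_rw [h4]
      rw [ENNReal.tsum_tsum_add_succ fun k K =>
        simplexCoeff e p k * (ENNReal.ofReal x ^ K * (K : ℝ≥0∞)⁻¹)]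
      refine tsum_congr fun K => ?_
      rw [simplexCoeff, if_pos hp, ← Finset.sum_mul]
      ring
    · obtain ⟨q, rfl⟩ : ∃ q, p = q + 1 :=
        Nat.exists_eq_succ_of_ne_zero fun h => hp (h ▸ he)
      have h2 : ∀ y ∈ Set.Ioo 0 x, (∑' k, simplexCoeff e (q + 1) k * ENNReal.ofReal y ^ k) *
          ENNReal.ofReal |y - if e (q + 1) then 1 else 0|⁻¹ =
          ∑' k, simplexCoeff e (q + 1) (k + 1) * ENNReal.ofReal y ^ k := by
        intro y hy
        rw [tsum_eq_zero_add' ENNReal.summable, simplexCoeff_succ_zero e he, zero_mul, zero_add,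
          ← ENNReal.tsum_mul_right]
        refine tsum_congr fun k => ?_
        rw [if_neg hp, sub_zero, abs_of_pos hy.1, ENNReal.ofReal_inv_of_pos hy.1, pow_succ,
          mul_assoc, mul_assoc, ENNReal.mul_inv_cancel (by simpa using hy.1) ENNReal.ofReal_ne_top,
          mul_one]
      rw [setLIntegral_congr_fun measurableSet_Ioo h2, lintegral_tsum fun k => by fun_prop,
        tsum_eq_zero_add' (f := fun k => simplexCoeff e (q + 1 + 1) k * _) ENNReal.summable,
        simplexCoeff_succ_zero e he (q + 1), zero_mul, zero_add]
      refine tsum_congr fun k => ?_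
      rw [lintegral_const_mul _ (by fun_prop), lintegral_Ioo_ofReal_pow hx0,
        show simplexCoeff e (q + 1 + 1) (k + 1) = (if e (q + 1) then _ else
          simplexCoeff e (q + 1) (k + 1)) * ((k + 1 : ℕ) : ℝ≥0∞)⁻¹ from rfl, if_neg hp]
      ring

theorem setLIntegral_simplexWeight (e : ℕ → Prop) [DecidablePred e] (he : e 0) {N : ℕ}
    (hN : 0 < N) :
    ∫⁻ t in {t : Fin N → ℝ | StrictMono t}, ∏ i : Fin N, simplexWeight e i (t i) =
      ∑' k, simplexCoeff e N k := by
  obtain ⟨N, rfl⟩ := Nat.exists_eq_succ_of_ne_zero hN.ne'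
  have h1 := setLIntegral_strictMono_prod volume (measurable_simplexWeight e) N
    (g := 1) measurable_one
  have h2 := iterLIntegral_simplexWeight e he (N + 1) zero_le_one le_rfl
  simp only [Pi.one_apply, mul_one] at h1
  simp only [ENNReal.ofReal_one, one_pow, mul_one] at h2
  rw [← h2, iterLIntegral]
  refine h1.trans ?_
  rw [← lintegral_indicator measurableSet_Iio]
  refine lintegral_congr fun x => ?_
  by_cases hx : x < 1
  · rw [Set.indicator_of_mem (show x ∈ Set.Iio 1 from hx)]
  · rw [Set.indicator_of_notMem (show x ∉ Set.Iio 1 from hx), simplexWeight,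
      Set.indicator_of_notMem fun h => hx h.2, mul_zero]

/-- The weight `k ^ (-n)` on positive integers `k`. -/
noncomputable def powWeight (n : ℕ → ℕ) (j k : ℕ) : ℝ≥0∞ :=
  if k = 0 then 0 else ((k : ℝ≥0∞) ^ n j)⁻¹

theorem setLIntegral_Iio_count (f : ℕ → ℝ≥0∞) (K : ℕ) :
    ∫⁻ l in Set.Iio K, f l ∂Measure.count = ∑ l ∈ Finset.range K, f l := by
  rw [← lintegral_indicator measurableSet_Iio, lintegral_count,
    tsum_eq_sum (s := Finset.range K) fun l hl => by simp_all]
  exact Finset.sum_congr rfl fun l hl => by simp_all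

theorem monotone_sum_range (n : ℕ → ℕ) : Monotone fun j => ∑ l ∈ Finset.range j, n l :=
  fun _ _ hab => Finset.sum_le_sum_of_subset (by simpa using hab)

theorem not_partialSum {n : ℕ → ℕ} (e : ℕ → Prop)
    (he : ∀ p, e p ↔ ∃ j, p = ∑ l ∈ Finset.range j, n l) (j r : ℕ) (hr : r + 1 < n j) :
    ¬ e (∑ l ∈ Finset.range j, n l + r + 1) := by
  rw [he]
  rintro ⟨i, hi⟩
  have hmono := monotone_sum_range n
  rcases le_or_gt i j with h | h
  · have := hmono h
    simp only at this
    omega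
  · have := hmono (show j + 1 ≤ i from h)
    simp only [Finset.sum_range_succ] at this
    omega

theorem simplexCoeff_add_succ {n : ℕ → ℕ} (hn : ∀ j, 1 ≤ n j) (e : ℕ → Prop) [DecidablePred e]
    (he : ∀ p, e p ↔ ∃ j, p = ∑ l ∈ Finset.range j, n l) (j r : ℕ) (hr : r + 1 ≤ n j) (K : ℕ) :
    simplexCoeff e (∑ l ∈ Finset.range j, n l + r + 1) K =
      iterLIntegral Measure.count (powWeight n) j K *
        (if K = 0 then 0 else ((K : ℝ≥0∞) ^ (r + 1))⁻¹) := by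
  have he0 : e 0 := (he 0).2 ⟨0, rfl⟩
  rcases Nat.eq_zero_or_pos K with rfl | hK
  · simp [simplexCoeff_succ_zero e he0]
  rw [if_neg hK.ne']
  have hrow (j r : ℕ) (hr : r + 1 ≤ n j) (K : ℕ) (hK : 0 < K) :
      simplexCoeff e (∑ l ∈ Finset.range j, n l + r + 1) K =
        (∑ l ∈ Finset.range K, simplexCoeff e (∑ l ∈ Finset.range j, n l) l) *
          ((K : ℝ≥0∞) ^ (r + 1))⁻¹ := by
    induction r with
    | zero =>
      rw [add_zero, simplexCoeff, if_pos ((he _).2 ⟨j, rfl⟩)]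
      simp
    | succ r ih =>
      rw [← add_assoc, simplexCoeff, if_neg (not_partialSum e he j r (by omega)),
        ih (by omega), pow_succ _ (r + 1), ENNReal.mul_inv (by simp) (by simp), mul_assoc]
  have hsum (j K : ℕ) (hK : 0 < K) :
      ∑ l ∈ Finset.range K, simplexCoeff e (∑ l ∈ Finset.range j, n l) l =
        iterLIntegral Measure.count (powWeight n) j K := by
    induction j generalizing K with
    | zero => simp [simplexCoeff, iterLIntegral, hK]
    | succ j ih =>
      rw [iterLIntegral, setLIntegral_Iio_count]
      refine Finset.sum_congr rfl fun l _ => ?_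
      have hj : ∑ l ∈ Finset.range (j + 1), n l =
          ∑ l ∈ Finset.range j, n l + (n j - 1) + 1 := by
        have := hn j
        rw [Finset.sum_range_succ]
        omega
      rw [hj]
      rcases Nat.eq_zero_or_pos l with rfl | hl
      · simp [simplexCoeff_succ_zero e he0, powWeight]
      · rw [hrow j _ (by have := hn j; omega) l hl, ih l hl, powWeight, if_neg hl.ne',
          Nat.sub_add_cancel (hn j)]
  rw [hrow j r hr K hK, hsum j K hK]

theorem iterLIntegral_powWeight_le {n : ℕ → ℕ} (hn : ∀ j, 1 ≤ n j) {a : ℝ} (ha : 0 < a)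
    (j K : ℕ) :
    iterLIntegral Measure.count (powWeight n) j K ≤
      (∑' l : ℕ, ENNReal.ofReal ((l : ℝ) ^ (-(1 + a)))) ^ j *
        ENNReal.ofReal ((K : ℝ) ^ (j * a)) := by
  set A := ∑' l : ℕ, ENNReal.ofReal ((l : ℝ) ^ (-(1 + a)))
  induction j generalizing K with
  | zero => simp [iterLIntegral]
  | succ j ih =>
    rw [iterLIntegral, setLIntegral_Iio_count]
    have h1 : ∀ l ∈ Finset.range K, iterLIntegral Measure.count (powWeight n) j l *
        powWeight n j l ≤ A ^ j * ENNReal.ofReal ((K : ℝ) ^ ((j + 1 : ℕ) * a)) *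
          ENNReal.ofReal ((l : ℝ) ^ (-(1 + a))) := by
      intro l hl
      rcases Nat.eq_zero_or_pos l with rfl | hl0
      · simp [powWeight]
      have hl1 : (0 : ℝ) < l := by exact_mod_cast hl0
      have hlK : (l : ℝ) ≤ K := by exact_mod_cast (Finset.mem_range.1 hl).le
      have h2 : powWeight n j l ≤ ENNReal.ofReal ((l : ℝ) ^ (-1 : ℝ)) := by
        rw [powWeight, if_neg hl0.ne', Real.rpow_neg_one, ENNReal.ofReal_inv_of_pos hl1,
          ENNReal.ofReal_natCast]
        refine ENNReal.inv_le_inv.2 (le_self_pow₀ ?_ ?_)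
        · exact_mod_cast hl0
        · have := hn j
          omega
      calc _ ≤ A ^ j * ENNReal.ofReal ((l : ℝ) ^ (j * a)) * ENNReal.ofReal ((l : ℝ) ^ (-1 : ℝ)) :=
            mul_le_mul' (ih l) h2
        _ = A ^ j * ENNReal.ofReal ((l : ℝ) ^ ((j + 1 : ℕ) * a)) *
            ENNReal.ofReal ((l : ℝ) ^ (-(1 + a))) := by
          rw [mul_assoc, mul_assoc, ← ENNReal.ofReal_mul (by positivity),
            ← ENNReal.ofReal_mul (by positivity), ← Real.rpow_add hl1, ← Real.rpow_add hl1]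
          congr 3
          push_cast
          ring
        _ ≤ _ := by gcongr
    refine (Finset.sum_le_sum h1).trans ?_
    rw [← Finset.mul_sum, pow_succ, mul_right_comm (A ^ j) A]
    gcongr
    exact ENNReal.sum_le_tsum _

theorem tsum_iterLIntegral_powWeight_ne_top {n : ℕ → ℕ} (hn : ∀ j, 1 ≤ n j) {m : ℕ}
    (hm : 2 ≤ n m) :
    ∑' k, iterLIntegral Measure.count (powWeight n) m k * powWeight n m k ≠ ⊤ := by
  set a : ℝ := (m + 1 : ℝ)⁻¹ with ha
  have ha0 : 0 < a := by positivity
  set A := ∑' l : ℕ, ENNReal.ofReal ((l : ℝ) ^ (-(1 + a))) with hA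
  have hA1 : A ≠ ⊤ := by
    refine Summable.tsum_ofReal_ne_top ?_
    exact Real.summable_nat_rpow.2 (by linarith)
  refine ne_top_of_le_ne_top (b := A ^ m * A) (by finiteness) ?_
  conv_rhs => rw [hA, ← ENNReal.tsum_mul_left]
  refine ENNReal.tsum_le_tsum fun k => ?_
  rcases Nat.eq_zero_or_pos k with rfl | hk0
  · simp [powWeight]
  have hk1 : (0 : ℝ) < k := by exact_mod_cast hk0
  have h2 : powWeight n m k ≤ ENNReal.ofReal ((k : ℝ) ^ (-2 : ℝ)) := by
    rw [powWeight, if_neg hk0.ne', Real.rpow_neg hk1.le, ENNReal.ofReal_inv_of_pos (by positivity),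
      Real.rpow_ofNat, ENNReal.ofReal_pow hk1.le, ENNReal.ofReal_natCast]
    exact ENNReal.inv_le_inv.2 (pow_le_pow_right₀ (by exact_mod_cast hk0) hm)
  refine (mul_le_mul' (iterLIntegral_powWeight_le hn ha0 m k) h2).trans_eq ?_
  rw [mul_assoc, ← ENNReal.ofReal_mul (by positivity), ← Real.rpow_add hk1]
  congr 3
  rw [ha]
  field_simp
  ring

theorem pi_count_eq_count (m : ℕ) :
    Measure.pi (fun _ : Fin m => (Measure.count : Measure ℕ)) = Measure.count := by
  refine Measure.ext_of_singleton fun k => ?_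
  rw [Measure.pi_singleton]
  simp

theorem tsum_strictMono_prod_powWeight (n : ℕ → ℕ) (m : ℕ) :
    ∑' k : {k : Fin (m + 1) → ℕ // StrictMono k ∧ 0 < k 0},
        ∏ i : Fin (m + 1), ((k.1 i : ℝ≥0∞) ^ n i)⁻¹ =
      ∑' K, iterLIntegral Measure.count (powWeight n) m K * powWeight n m K := by
  have h := setLIntegral_strictMono_prod Measure.count (f := powWeight n)
    (fun _ => measurable_of_countable _) m (g := 1) measurable_one
  rw [pi_count_eq_count, ← lintegral_indicator (measurableSet_strictMono _), lintegral_count,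
    lintegral_count] at h
  simp only [Pi.one_apply, mul_one] at h
  rw [← h]
  refine (tsum_subtype {k : Fin (m + 1) → ℕ | StrictMono k ∧ 0 < k 0}
    fun k => ∏ i : Fin (m + 1), ((k i : ℝ≥0∞) ^ n i)⁻¹).trans (tsum_congr fun k => ?_)
  by_cases h1 : StrictMono k
  · rw [Set.indicator_of_mem (show k ∈ {k : Fin (m + 1) → ℕ | StrictMono k} from h1)]
    by_cases h2 : 0 < k 0
    · rw [Set.indicator_of_mem
        (show k ∈ {k : Fin (m + 1) → ℕ | StrictMono k ∧ 0 < k 0} from ⟨h1, h2⟩)]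
      refine Finset.prod_congr rfl fun i _ => ?_
      rw [powWeight, if_neg (h2.trans_le (h1.monotone (Fin.zero_le i))).ne']
    · rw [Set.indicator_of_notMem fun h => h2 h.2]
      refine (Finset.prod_eq_zero (Finset.mem_univ 0) ?_).symm
      rw [powWeight, if_pos (by omega)]
  · rw [Set.indicator_of_notMem fun h => h1 h.1, Set.indicator_of_notMem h1]

theorem prod_ite_partialSum {n : ℕ → ℕ} (hn : ∀ j, 1 ≤ n j) (e : ℕ → Prop) [DecidablePred e]
    (he : ∀ p, e p ↔ ∃ j, p = ∑ l ∈ Finset.range j, n l) (m : ℕ) :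
    ∏ i ∈ Finset.range (∑ l ∈ Finset.range m, n l), (if e i then (-1 : ℝ) else 1) =
      (-1) ^ m := by
  induction m with
  | zero => simp
  | succ m ih =>
    obtain ⟨r, hr⟩ := Nat.exists_eq_succ_of_ne_zero (Nat.one_le_iff_ne_zero.1 (hn m))
    have h1 : ∀ i ∈ Finset.range r,
        (if e (∑ l ∈ Finset.range m, n l + (i + 1)) then (-1 : ℝ) else 1) = 1 := by
      intro i hi
      exact if_neg (not_partialSum e he m i (by have := Finset.mem_range.1 hi; omega))
    rw [Finset.sum_range_succ, Finset.prod_range_add, ih, hr, Finset.prod_range_succ',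
      Finset.prod_congr rfl h1, add_zero, if_pos ((he _).2 ⟨m, rfl⟩)]
    simp [pow_succ]

/-- The Leibniz–Kontsevich integral representation of multiple zeta values.
For positive integers `n 0, …, n (m-1)` with the last one at least `2`, setting
`N = ∑ i, n i` and `ε i = 1` exactly when `i` is one of the partial sums
`∑_{l < j} n l` (`j : Fin m`), i.e. the `1`-indexed positions `1, n₁+1, n₁+n₂+1, …`,
the multiple zeta value `ζ(n₁,…,n_m)` (a convergent sum) equals
`(-1)^m` times the (absolutely convergent) Lebesgue integral of
`∏ i, (t i - ε i)⁻¹` over the open ordered simplex `0 < t 0 < ⋯ < t (N-1) < 1`. -/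
theorem multiple_zeta_value_eq_integral (m : ℕ) (hm : 0 < m) (n : Fin m → ℕ)
    (hn : ∀ i, 1 ≤ n i) (hlast : 2 ≤ n ⟨m - 1, Nat.sub_lt hm one_pos⟩) :
    Summable (fun k : {k : Fin m → ℕ // StrictMono k ∧ 0 < k ⟨0, hm⟩} =>
      ∏ i, (((k.1 i : ℝ)) ^ (n i))⁻¹) ∧
    IntegrableOn
      (fun t : Fin (∑ i, n i) → ℝ => ∏ i,
        (t i - (if ∃ j : Fin m, (i : ℕ) = ∑ l ∈ Finset.Iio j, n l then (1 : ℝ) else 0))⁻¹)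
      {t : Fin (∑ i, n i) → ℝ | StrictMono t ∧ ∀ i, t i ∈ Set.Ioo (0 : ℝ) 1} volume ∧
    (∑' k : {k : Fin m → ℕ // StrictMono k ∧ 0 < k ⟨0, hm⟩},
        ∏ i, (((k.1 i : ℝ)) ^ (n i))⁻¹) =
      (-1 : ℝ) ^ m *
        ∫ t in {t : Fin (∑ i, n i) → ℝ | StrictMono t ∧ ∀ i, t i ∈ Set.Ioo (0 : ℝ) 1},
          ∏ i, (t i -
            (if ∃ j : Fin m, (i : ℕ) = ∑ l ∈ Finset.Iio j, n l then (1 : ℝ) else 0))⁻¹ := by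
  classical
  obtain ⟨m, rfl⟩ := Nat.exists_eq_succ_of_ne_zero hm.ne'
  set n' : ℕ → ℕ := fun i => if h : i < m + 1 then n ⟨i, h⟩ else 1 with hn'
  have hn'1 : ∀ j, 1 ≤ n' j := by
    intro j
    simp only [hn']
    split_ifs
    exacts [hn _, le_rfl]
  have hn'v : ∀ i : Fin (m + 1), n i = n' i := fun i => by
    simp only [hn', dif_pos i.2]
  set N := ∑ i, n i with hN
  have hNs : N = ∑ l ∈ Finset.range (m + 1), n' l := by
    rw [hN, Finset.sum_range]
    exact Finset.sum_congr rfl fun i _ => hn'v i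
  have hIio : ∀ j : Fin (m + 1), ∑ l ∈ Finset.Iio j, n l = ∑ l ∈ Finset.range j, n' l := by
    intro j
    rw [← Nat.Iio_eq_range, ← Fin.map_valEmbedding_Iio, Finset.sum_map]
    exact Finset.sum_congr rfl fun i _ => hn'v i
  set e : ℕ → Prop := fun p => ∃ j, p = ∑ l ∈ Finset.range j, n' l with he_def
  have he : ∀ p, e p ↔ ∃ j, p = ∑ l ∈ Finset.range j, n' l := fun p => Iff.rfl
  have hmono := monotone_sum_range n'
  have hiff : ∀ i : Fin N, (∃ j : Fin (m + 1), (i : ℕ) = ∑ l ∈ Finset.Iio j, n l) ↔ e i := by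
    intro i
    constructor
    · rintro ⟨j, hj⟩
      exact ⟨j, by rw [hj, hIio]⟩
    · rintro ⟨j, hj⟩
      have hjm : j < m + 1 := by
        by_contra h
        have h1 := hmono (not_lt.1 h)
        have h2 := i.2
        simp only at h1
        omega
      exact ⟨⟨j, hjm⟩, by rw [hj, hIio]⟩
  simp only [hiff]
  have hlast' : 2 ≤ n' m := by
    have := hn'v (Fin.last m)
    rw [Fin.val_last] at this
    exact this ▸ hlast
  have hNpos : 0 < N := by
    rw [hNs, Finset.sum_range_succ]
    omega
  set F : (Fin N → ℝ) → ℝ := fun t => ∏ i, (t i - if e i then 1 else 0)⁻¹ with hF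
  set S := {t : Fin N → ℝ | StrictMono t ∧ ∀ i, t i ∈ Set.Ioo (0 : ℝ) 1} with hS
  have hSm : MeasurableSet S := by
    have : S = {t | StrictMono t} ∩ ⋂ i, (fun t => t i) ⁻¹' Set.Ioo (0 : ℝ) 1 := by
      ext t
      simp [hS]
    rw [this]
    exact (measurableSet_strictMono N).inter
      (MeasurableSet.iInter fun i => measurable_pi_apply i measurableSet_Ioo)
  have hsign : ∀ t ∈ S, (-1) ^ (m + 1) * F t = ∏ i, |t i - if e i then 1 else 0|⁻¹ := by
    intro t ht
    rw [← prod_ite_partialSum hn'1 e he (m + 1), ← hNs, Finset.prod_range, hF,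
      ← Finset.prod_mul_distrib]
    refine Finset.prod_congr rfl fun i _ => ?_
    have h0 := ht.2 i
    by_cases hi : e i
    · rw [if_pos hi, if_pos hi, abs_of_neg (by linarith [h0.2]), neg_one_mul, inv_neg]
    · rw [if_neg hi, if_neg hi, sub_zero, abs_of_pos h0.1, one_mul]
  have hlint : ∫⁻ t in S, ENNReal.ofReal ((-1) ^ (m + 1) * F t) =
      ∑' K, iterLIntegral Measure.count (powWeight n') m K * powWeight n' m K := by
    have h1 : ∑' K, iterLIntegral Measure.count (powWeight n') m K * powWeight n' m K =
        ∑' k, simplexCoeff e N k := by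
      refine tsum_congr fun K => ?_
      have h2 := simplexCoeff_add_succ hn'1 e he m (n' m - 1) (by omega) K
      rw [add_assoc, Nat.sub_add_cancel (hn'1 m), ← Finset.sum_range_succ, ← hNs] at h2
      rw [h2, powWeight]
    rw [h1, ← setLIntegral_simplexWeight e ⟨0, rfl⟩ hNpos, ← lintegral_indicator hSm,
      ← lintegral_indicator (measurableSet_strictMono N)]
    refine lintegral_congr fun t => ?_
    by_cases ht : t ∈ S
    · rw [Set.indicator_of_mem ht,
        Set.indicator_of_mem (show t ∈ {t : Fin N → ℝ | StrictMono t} from ht.1), hsign t ht,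
        ENNReal.ofReal_prod_of_nonneg fun i _ => by positivity]
      refine Finset.prod_congr rfl fun i _ => ?_
      rw [simplexWeight, Set.indicator_of_mem (ht.2 i)]
    · rw [Set.indicator_of_notMem ht]
      refine (Set.indicator_apply_eq_zero.2 fun hts => ?_).symm
      obtain ⟨i, hi⟩ : ∃ i, t i ∉ Set.Ioo (0 : ℝ) 1 := by
        by_contra! h
        exact ht ⟨hts, h⟩
      exact Finset.prod_eq_zero (Finset.mem_univ i) (Set.indicator_of_notMem hi _)
  have hfin := tsum_iterLIntegral_powWeight_ne_top hn'1 hlast'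
  have hFm : Measurable fun t => (-1) ^ (m + 1) * F t := by
    refine Measurable.const_mul (Finset.measurable_prod _ fun i _ => ?_) _
    fun_prop
  have hnn : 0 ≤ᵐ[volume.restrict S] fun t => (-1) ^ (m + 1) * F t := by
    filter_upwards [ae_restrict_mem hSm] with t ht
    rw [hsign t ht]
    exact Finset.prod_nonneg fun i _ => by positivity
  have hint : IntegrableOn (fun t => (-1) ^ (m + 1) * F t) S := by
    refine ⟨hFm.aestronglyMeasurable, ?_⟩
    rw [hasFiniteIntegral_iff_ofReal hnn, hlint]
    exact hfin.lt_top
  have hG : ∀ k : {k : Fin (m + 1) → ℕ // StrictMono k ∧ 0 < k ⟨0, hm⟩},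
      ENNReal.ofReal (∏ i, ((k.1 i : ℝ) ^ n i)⁻¹) =
        ∏ i : Fin (m + 1), ((k.1 i : ℝ≥0∞) ^ n' i)⁻¹ := by
    intro k
    rw [ENNReal.ofReal_prod_of_nonneg fun i _ => by positivity]
    refine Finset.prod_congr rfl fun i _ => ?_
    have hk : 0 < k.1 i := k.2.2.trans_le (k.2.1.monotone (Fin.zero_le i))
    rw [ENNReal.ofReal_inv_of_pos (by positivity), ENNReal.ofReal_pow (by positivity),
      ENNReal.ofReal_natCast, hn'v]
  have hsum := tsum_strictMono_prod_powWeight n' m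
  have hsum' : ∑' k : {k : Fin (m + 1) → ℕ // StrictMono k ∧ 0 < k ⟨0, hm⟩},
      ENNReal.ofReal (∏ i, ((k.1 i : ℝ) ^ n i)⁻¹) =
      ∑' K, iterLIntegral Measure.count (powWeight n') m K * powWeight n' m K :=
    (tsum_congr hG).trans hsum
  have hpos : ∀ k : {k : Fin (m + 1) → ℕ // StrictMono k ∧ 0 < k ⟨0, hm⟩},
      0 ≤ ∏ i, ((k.1 i : ℝ) ^ n i)⁻¹ := fun k => Finset.prod_nonneg fun i _ => by positivity
  have hsummable : Summable fun k : {k : Fin (m + 1) → ℕ // StrictMono k ∧ 0 < k ⟨0, hm⟩} =>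
      ∏ i, ((k.1 i : ℝ) ^ n i)⁻¹ := by
    have := ENNReal.summable_toReal (hsum'.trans_ne hfin)
    exact this.congr fun k => ENNReal.toReal_ofReal (hpos k)
  refine ⟨hsummable, ?_, ?_⟩
  · refine (hint.const_mul ((-1) ^ (m + 1))).congr (ae_of_all _ fun t => ?_)
    simp only [← mul_assoc, ← mul_pow]
    simp
  · rw [← integral_const_mul, integral_eq_lintegral_of_nonneg_ae hnn hFm.aestronglyMeasurable,
      hlint, ← hsum', ← ENNReal.ofReal_tsum_of_nonneg hpos hsummable,
      ENNReal.toReal_ofReal (tsum_nonneg hpos)]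
end

section
/- (Picard–Fuchs equation for the periods of the Legendre family.) Define F : (0,1) → ℝ by F(t) := ∫_0^1 dx/√(x(1−x)(1−tx)). Then F is twice differentiable on (0,1) and satisfies the differential equation 4t(1−t)·F''(t) + 4(1−2t)·F'(t) − F(t) = 0 for every t ∈ (0,1). -/
open Set

theorem intervalIntegrable_inv_sqrt_mul_one_sub :
    IntervalIntegrable (fun x : ℝ => (Real.sqrt (x * (1 - x)))⁻¹) MeasureTheory.volume 0 1 := by
  refine intervalIntegral.intervalIntegrable_deriv_of_nonneg
    (g := fun x => Real.arcsin (2 * x - 1)) (by fun_prop) (fun x hx => ?_)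
    (fun x _ => by positivity)
  rw [min_eq_left zero_le_one, max_eq_right zero_le_one] at hx
  obtain ⟨h0, h1⟩ := hx
  have h := (Real.hasDerivAt_arcsin (x := 2 * x - 1) (by linarith) (by linarith)).comp x
    (((hasDerivAt_id x).const_mul 2).sub_const 1)
  refine h.congr_deriv ?_
  have hs : Real.sqrt (1 - (2 * x - 1) ^ 2) = 2 * Real.sqrt (x * (1 - x)) := by
    rw [show 1 - (2 * x - 1) ^ 2 = 2 ^ 2 * (x * (1 - x)) by ring,
      Real.sqrt_mul (by norm_num), Real.sqrt_sq (by norm_num)]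
  have : Real.sqrt (x * (1 - x)) ≠ 0 :=
    (Real.sqrt_pos.2 (mul_pos h0 (by linarith))).ne'
  rw [hs]
  field_simp

theorem HasDerivAt.inv_sqrt_pow {f : ℝ → ℝ} {f' y : ℝ} (hf : HasDerivAt f f' y)
    (hy : 0 < f y) (k : ℕ) :
    HasDerivAt (fun z => (Real.sqrt (f z))⁻¹ ^ k)
      (-(k / 2 * f') * (Real.sqrt (f y))⁻¹ ^ (k + 2)) y := by
  have hs : Real.sqrt (f y) ≠ 0 := (Real.sqrt_pos.2 hy).ne'
  refine (((hf.sqrt hy.ne').inv hs).pow k).congr_deriv ?_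
  rcases k with _ | k
  · simp
  · simp only [Nat.add_sub_cancel, Pi.inv_apply]
    ring

/-- The integrand of the (rescaled) derivatives of the Legendre period. -/
noncomputable def legendreIntegrand (n k : ℕ) (t x : ℝ) : ℝ :=
  (Real.sqrt (x * (1 - x)))⁻¹ * (x ^ n * (Real.sqrt (1 - t * x))⁻¹ ^ k)

theorem one_sub_le_one_sub_mul {c s x : ℝ} (hc : 0 ≤ c) (hs : s ≤ c) (hx : x ∈ Ioc (0 : ℝ) 1) :
    1 - c ≤ 1 - s * x := by
  nlinarith [hx.1, hx.2]

theorem norm_legendreIntegrand_le {c s x : ℝ} (hc : c ∈ Ico (0 : ℝ) 1) (hs : s ≤ c)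
    (hx : x ∈ Ioc (0 : ℝ) 1) (n k : ℕ) :
    ‖legendreIntegrand n k s x‖ ≤
      (Real.sqrt (x * (1 - x)))⁻¹ * (Real.sqrt (1 - c))⁻¹ ^ k := by
  have h0 : 0 ≤ x := hx.1.le
  have hpos : 0 < Real.sqrt (1 - c) := Real.sqrt_pos.2 (by linarith [hc.2])
  rw [legendreIntegrand, Real.norm_of_nonneg (by positivity)]
  have hle := one_sub_le_one_sub_mul hc.1 hs hx
  calc _ ≤ (Real.sqrt (x * (1 - x)))⁻¹ * (1 * (Real.sqrt (1 - c))⁻¹ ^ k) := by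
        gcongr
        exact pow_le_one₀ h0 hx.2
    _ = _ := by rw [one_mul]

theorem measurable_legendreIntegrand (n k : ℕ) (t : ℝ) : Measurable (legendreIntegrand n k t) := by
  unfold legendreIntegrand
  fun_prop

theorem intervalIntegrable_legendreIntegrand (n k : ℕ) {t : ℝ} (ht : t ∈ Ioo (0 : ℝ) 1) :
    IntervalIntegrable (legendreIntegrand n k t) MeasureTheory.volume 0 1 := by
  refine (intervalIntegrable_inv_sqrt_mul_one_sub.mul_const
    ((Real.sqrt (1 - t))⁻¹ ^ k)).mono_fun'
      (measurable_legendreIntegrand n k t).aestronglyMeasurable ?_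
  refine (MeasureTheory.ae_restrict_iff' measurableSet_uIoc).2 (.of_forall fun x hx => ?_)
  rw [uIoc_of_le zero_le_one] at hx
  exact norm_legendreIntegrand_le ⟨ht.1.le, ht.2⟩ le_rfl hx n k

theorem hasDerivAt_integral_legendreIntegrand (n k : ℕ) {t : ℝ} (ht : t ∈ Ioo (0 : ℝ) 1) :
    HasDerivAt (fun s => ∫ x in (0 : ℝ)..1, legendreIntegrand n k s x)
      (k / 2 * ∫ x in (0 : ℝ)..1, legendreIntegrand (n + 1) (k + 2) t x) t := by
  obtain ⟨c, htc, hc1⟩ := exists_between ht.2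
  have hc0 : 0 < c := ht.1.trans htc
  rw [← intervalIntegral.integral_const_mul]
  refine (intervalIntegral.hasDerivAt_integral_of_dominated_loc_of_deriv_le
    (F' := fun s x => k / 2 * legendreIntegrand (n + 1) (k + 2) s x)
    (bound := fun x =>
      k / 2 * ((Real.sqrt (x * (1 - x)))⁻¹ * (Real.sqrt (1 - c))⁻¹ ^ (k + 2)))
    (Iio_mem_nhds htc)
    (.of_forall fun s => (measurable_legendreIntegrand n k s).aestronglyMeasurable)
    (intervalIntegrable_legendreIntegrand n k ht)
    ((measurable_legendreIntegrand _ _ t).const_mul _).aestronglyMeasurable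
    (.of_forall fun x hx s hs => ?_)
    ((intervalIntegrable_inv_sqrt_mul_one_sub.mul_const _).const_mul _)
    (.of_forall fun x hx s hs => ?_)).2
  · rw [uIoc_of_le zero_le_one] at hx
    rw [norm_mul, Real.norm_of_nonneg (by positivity : (0 : ℝ) ≤ k / 2)]
    gcongr
    exact norm_legendreIntegrand_le ⟨hc0.le, hc1⟩ (le_of_lt hs) hx _ _
  · rw [uIoc_of_le zero_le_one] at hx
    have hpos : 0 < 1 - s * x := by
      linarith [one_sub_le_one_sub_mul hc0.le (le_of_lt hs) hx]
    have hlin : HasDerivAt (fun z => 1 - z * x) (-x) s := by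
      simpa using ((hasDerivAt_id s).mul_const x).const_sub 1
    refine (((hlin.inv_sqrt_pow hpos k).const_mul (x ^ n)).const_mul
      (Real.sqrt (x * (1 - x)))⁻¹).congr_deriv ?_
    unfold legendreIntegrand
    ring

/-- The Picard–Fuchs combination of the integrands is an exact differential. -/
theorem hasDerivAt_legendre_primitive {t x : ℝ} (ht : t ∈ Ioo (0 : ℝ) 1)
    (hx : x ∈ Ioo (0 : ℝ) 1) :
    HasDerivAt (fun z => -2 * (Real.sqrt (z * (1 - z)) * (Real.sqrt (1 - t * z))⁻¹ ^ 3))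
      (3 * t * (1 - t) * legendreIntegrand 2 5 t x +
        2 * (1 - 2 * t) * legendreIntegrand 1 3 t x - legendreIntegrand 0 1 t x) x := by
  have hx' : 0 < x * (1 - x) := mul_pos hx.1 (by linarith [hx.2])
  have hu : 0 < 1 - t * x := by
    linarith [one_sub_le_one_sub_mul ht.1.le le_rfl ⟨hx.1, hx.2.le⟩, ht.2]
  have hlin : HasDerivAt (fun z => 1 - t * z) (-t) x := by
    simpa using ((hasDerivAt_id x).const_mul t).const_sub 1
  have hquad : HasDerivAt (fun z => z * (1 - z)) (1 - 2 * x) x :=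
    ((hasDerivAt_id x).mul ((hasDerivAt_id x).const_sub 1)).congr_deriv (by simp; ring)
  refine (((hquad.sqrt hx'.ne').mul (hlin.inv_sqrt_pow hu 3)).const_mul (-2)).congr_deriv ?_
  have hp : 0 < Real.sqrt (x * (1 - x)) := Real.sqrt_pos.2 hx'
  have hq : 0 < Real.sqrt (1 - t * x) := Real.sqrt_pos.2 hu
  have hp2 : Real.sqrt (x * (1 - x)) ^ 2 = x * (1 - x) := Real.sq_sqrt hx'.le
  have hq2 : Real.sqrt (1 - t * x) ^ 2 = 1 - t * x := Real.sq_sqrt hu.le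
  have hq4 : Real.sqrt (1 - t * x) ^ 4 = (1 - t * x) ^ 2 := by
    rw [show Real.sqrt (1 - t * x) ^ 4 = (Real.sqrt (1 - t * x) ^ 2) ^ 2 by ring, hq2]
  unfold legendreIntegrand
  generalize Real.sqrt (x * (1 - x)) = p at *
  generalize Real.sqrt (1 - t * x) = q at *
  push_cast
  field_simp
  ring_nf
  simp only [hp2, hq2, hq4]
  ring

theorem picard_fuchs_integral_legendreIntegrand {t : ℝ} (ht : t ∈ Ioo (0 : ℝ) 1) :
    3 * t * (1 - t) * (∫ x in (0 : ℝ)..1, legendreIntegrand 2 5 t x) +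
      2 * (1 - 2 * t) * (∫ x in (0 : ℝ)..1, legendreIntegrand 1 3 t x) -
      (∫ x in (0 : ℝ)..1, legendreIntegrand 0 1 t x) = 0 := by
  have h2 := (intervalIntegrable_legendreIntegrand 2 5 ht).const_mul (3 * t * (1 - t))
  have h1 := (intervalIntegrable_legendreIntegrand 1 3 ht).const_mul (2 * (1 - 2 * t))
  have h0 := intervalIntegrable_legendreIntegrand 0 1 ht
  have hcont : ContinuousOn
      (fun z => -2 * (Real.sqrt (z * (1 - z)) * (Real.sqrt (1 - t * z))⁻¹ ^ 3)) (Icc 0 1) := by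
    have hne : ∀ z ∈ Icc (0 : ℝ) 1, Real.sqrt (1 - t * z) ≠ 0 := fun z hz =>
      (Real.sqrt_pos.2 (by nlinarith [hz.1, hz.2, ht.1, ht.2])).ne'
    have hinv : ContinuousOn (fun z => (Real.sqrt (1 - t * z))⁻¹) (Icc 0 1) :=
      ContinuousOn.inv₀ (by fun_prop) hne
    fun_prop
  have key := intervalIntegral.integral_eq_sub_of_hasDerivAt_of_le zero_le_one hcont
    (fun x hx => hasDerivAt_legendre_primitive ht hx) ((h2.add h1).sub h0)
  rw [intervalIntegral.integral_sub (h2.add h1) h0, intervalIntegral.integral_add h2 h1,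
    intervalIntegral.integral_const_mul, intervalIntegral.integral_const_mul] at key
  simpa using key

theorem integral_inv_sqrt_eq_legendreIntegrand (s : ℝ) :
    ∫ x in (0 : ℝ)..1, (Real.sqrt (x * (1 - x) * (1 - s * x)))⁻¹ =
      ∫ x in (0 : ℝ)..1, legendreIntegrand 0 1 s x := by
  refine intervalIntegral.integral_congr fun x hx => ?_
  rw [uIcc_of_le zero_le_one] at hx
  simp only [legendreIntegrand]
  rw [Real.sqrt_mul (mul_nonneg hx.1 (by linarith [hx.2])), mul_inv]
  simp

/-- The Picard–Fuchs equation for the periods of the Legendre family: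
`F t = ∫₀¹ dx / √(x(1-x)(1-tx))` is twice differentiable on `(0,1)` and satisfies
`4t(1-t) F'' + 4(1-2t) F' - F = 0` there. -/
theorem legendre_period_picard_fuchs :
    ∃ F' F'' : ℝ → ℝ,
      (∀ t ∈ Ioo (0 : ℝ) 1,
        HasDerivAt (fun s : ℝ => ∫ x in (0 : ℝ)..1,
          (Real.sqrt (x * (1 - x) * (1 - s * x)))⁻¹) (F' t) t) ∧
      (∀ t ∈ Ioo (0 : ℝ) 1, HasDerivAt F' (F'' t) t) ∧
      (∀ t ∈ Ioo (0 : ℝ) 1,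
        4 * t * (1 - t) * F'' t + 4 * (1 - 2 * t) * F' t -
          (∫ x in (0 : ℝ)..1, (Real.sqrt (x * (1 - x) * (1 - t * x)))⁻¹) = 0) := by
  simp only [integral_inv_sqrt_eq_legendreIntegrand]
  refine ⟨fun t => 1 / 2 * ∫ x in (0 : ℝ)..1, legendreIntegrand 1 3 t x,
    fun t => 1 / 2 * (3 / 2 * ∫ x in (0 : ℝ)..1, legendreIntegrand 2 5 t x),
    fun t ht => ?_, fun t ht => ?_, fun t ht => ?_⟩
  · simpa using hasDerivAt_integral_legendreIntegrand 0 1 ht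
  · exact (hasDerivAt_integral_legendreIntegrand 1 3 ht).const_mul (1 / 2)
  · linear_combination picard_fuchs_integral_legendreIntegrand ht
end

section
/- (Witt-vector characterization of p-derivations.) Let p be a prime, let A and B be commutative rings, let f : A → B be a ring homomorphism, and let δ : A → B be any map. Then the map A → W₂(B) sending a to the p-typical Witt vector of length 2 with components (f(a), δ(a)) is a ring homomorphism if and only if δ is a p-derivation with respect to f, i.e., δ(1) = 0, δ(x+y) = δ(x) + δ(y) + C_p(f(x), f(y)) for all x, y ∈ A, and δ(xy) = f(x)^p·δ(y) + f(y)^p·δ(x) + p·δ(x)·δ(y) for all x, y ∈ A. -/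
open MvPolynomial

namespace WittVector

variable {p : ℕ} [hp : Fact p.Prime]

theorem wittAdd_one {Cp : MvPolynomial (Fin 2) ℤ}
    (hCp : (p : MvPolynomial (Fin 2) ℤ) * Cp = X 0 ^ p + X 1 ^ p - (X 0 + X 1) ^ p) :
    wittAdd p 1 = X (0, 1) + X (1, 1) + rename (fun i => (i, 0)) Cp := by
  have hp0 : (p : MvPolynomial (Fin 2 × ℕ) ℤ) ≠ 0 := Nat.cast_ne_zero.2 hp.out.ne_zero
  have h := wittStructureInt_prop p (X 0 + X 1 : MvPolynomial (Fin 2) ℤ) 1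
  have hC := congrArg (rename fun i : Fin 2 => (i, (0 : ℕ))) hCp
  have h0 := wittAdd_zero p
  simp only [wittAdd] at h0 ⊢
  simp [wittPolynomial_one, h0] at h hC
  apply mul_left_cancel₀ hp0
  linear_combination h - hC

theorem wittMul_one :
    wittMul p 1 = X (0, 0) ^ p * X (1, 1) + X (1, 0) ^ p * X (0, 1) +
      (p : MvPolynomial (Fin 2 × ℕ) ℤ) * X (0, 1) * X (1, 1) := by
  have hp0 : (p : MvPolynomial (Fin 2 × ℕ) ℤ) ≠ 0 := Nat.cast_ne_zero.2 hp.out.ne_zero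
  have h := wittStructureInt_prop p (X 0 * X 1 : MvPolynomial (Fin 2) ℤ) 1
  have h0 := wittMul_zero p
  simp only [wittMul] at h0 ⊢
  simp [wittPolynomial_one, h0] at h
  apply mul_left_cancel₀ hp0
  linear_combination h

variable {R : Type*} [CommRing R]

theorem add_coeff_one {Cp : MvPolynomial (Fin 2) ℤ}
    (hCp : (p : MvPolynomial (Fin 2) ℤ) * Cp = X 0 ^ p + X 1 ^ p - (X 0 + X 1) ^ p)
    (x y : WittVector p R) :
    (x + y).coeff 1 = x.coeff 1 + y.coeff 1 + aeval ![x.coeff 0, y.coeff 0] Cp := by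
  have h : (Function.uncurry ![x.coeff, y.coeff] ∘ fun i : Fin 2 => (i, 0)) =
      ![x.coeff 0, y.coeff 0] := by
    ext i
    fin_cases i <;> rfl
  rw [add_coeff, wittAdd_one hCp]
  simp [peval, aeval_rename, h]

theorem mul_coeff_one (x y : WittVector p R) :
    (x * y).coeff 1 = x.coeff 0 ^ p * y.coeff 1 + y.coeff 0 ^ p * x.coeff 1 +
      (p : R) * x.coeff 1 * y.coeff 1 := by
  rw [mul_coeff, wittMul_one]
  simp [peval]

end WittVector

namespace TruncatedWittVector

variable {p : ℕ} {R : Type*}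

theorem mk_two_inj {a b c d : R} :
    mk p ![a, b] = mk p ![c, d] ↔ a = c ∧ b = d := by
  refine ⟨fun h => ⟨congrArg (fun v => v.coeff 0) h, congrArg (fun v => v.coeff 1) h⟩, ?_⟩
  rintro ⟨rfl, rfl⟩
  rfl

theorem truncateFun_two (x : WittVector p R) :
    WittVector.truncateFun 2 x = mk p ![x.coeff 0, x.coeff 1] := by
  ext i
  fin_cases i <;> rfl

theorem mk_two_eq_truncateFun (a b : R) :
    mk p ![a, b] =
      WittVector.truncateFun 2 (WittVector.mk p fun n => if n = 0 then a else b) := by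
  rw [truncateFun_two]
  simp

variable [hp : Fact p.Prime] [CommRing R]

theorem mk_two_add {Cp : MvPolynomial (Fin 2) ℤ}
    (hCp : (p : MvPolynomial (Fin 2) ℤ) * Cp = X 0 ^ p + X 1 ^ p - (X 0 + X 1) ^ p)
    (a b c d : R) :
    mk p ![a, b] + mk p ![c, d] = mk p ![a + c, b + d + aeval ![a, c] Cp] := by
  rw [mk_two_eq_truncateFun a, mk_two_eq_truncateFun c, ← WittVector.truncateFun_add,
    truncateFun_two, WittVector.add_coeff_zero, WittVector.add_coeff_one hCp]
  simp

theorem mk_two_mul (a b c d : R) :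
    mk p ![a, b] * mk p ![c, d] =
      mk p ![a * c, a ^ p * d + c ^ p * b + (p : R) * b * d] := by
  rw [mk_two_eq_truncateFun a, mk_two_eq_truncateFun c, ← WittVector.truncateFun_mul,
    truncateFun_two, WittVector.mul_coeff_zero, WittVector.mul_coeff_one]
  simp

theorem one_eq_mk_two : (1 : TruncatedWittVector p 2 R) = mk p ![1, 0] := by
  rw [← WittVector.truncateFun_one, truncateFun_two, WittVector.one_coeff_zero,
    WittVector.one_coeff_eq_of_pos _ _ _ one_pos]

end TruncatedWittVector

/-- Witt-vector characterization of `p`-derivations: for a ring homomorphism `f : A → B`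
and a map `δ : A → B`, the map `a ↦ (f a, δ a)` into the length-2 `p`-typical Witt
vectors `W₂(B)` is a ring homomorphism if and only if `δ` is a `p`-derivation with
respect to `f`. -/
theorem p_derivation_iff_witt_length_two_hom (p : ℕ) [Fact p.Prime]
    (A B : Type*) [CommRing A] [CommRing B] (f : A →+* B) (δ : A → B)
    (Cp : MvPolynomial (Fin 2) ℤ)
    (hCp : (p : MvPolynomial (Fin 2) ℤ) * Cp = X 0 ^ p + X 1 ^ p - (X 0 + X 1) ^ p) :
    (∃ F : A →+* TruncatedWittVector p 2 B,
        ∀ a : A, F a = TruncatedWittVector.mk p ![f a, δ a]) ↔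
      (δ 1 = 0 ∧
        (∀ x y : A, δ (x + y) = δ x + δ y + aeval ![f x, f y] Cp) ∧
        (∀ x y : A,
          δ (x * y) = f x ^ p * δ y + f y ^ p * δ x + (p : B) * δ x * δ y)) := by
  constructor
  · rintro ⟨F, hF⟩
    refine ⟨?_, fun x y => ?_, fun x y => ?_⟩
    · have h := map_one F
      rw [hF, TruncatedWittVector.one_eq_mk_two, TruncatedWittVector.mk_two_inj] at h
      exact h.2
    · have h := map_add F x y
      rw [hF, hF, hF, TruncatedWittVector.mk_two_add hCp, TruncatedWittVector.mk_two_inj] at h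
      exact h.2
    · have h := map_mul F x y
      rw [hF, hF, hF, TruncatedWittVector.mk_two_mul, TruncatedWittVector.mk_two_inj] at h
      exact h.2
  · rintro ⟨h1, hadd, hmul⟩
    let φ : A →* TruncatedWittVector p 2 B :=
      { toFun := fun a => TruncatedWittVector.mk p ![f a, δ a]
        map_one' := by rw [map_one, h1, TruncatedWittVector.one_eq_mk_two]
        map_mul' := fun x y => by rw [TruncatedWittVector.mk_two_mul, map_mul, hmul] }
    exact ⟨RingHom.mk' φ fun x y => by
      change TruncatedWittVector.mk p ![f (x + y), δ (x + y)] =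
        TruncatedWittVector.mk p ![f x, δ x] + TruncatedWittVector.mk p ![f y, δ y]
      rw [TruncatedWittVector.mk_two_add hCp, map_add, hadd], fun a => rfl⟩
end

section
/- (Series formula for the quadratic residue symbol, Example 2 of 2.2.) Let p be an odd prime and a ∈ ℤ_p^×, and set δ(a) := (a − a^p)/p ∈ ℤ_p. Then the series 1 + ∑_{k=1}^∞ (−1)^{k−1} ((2k−2)! / (2^{2k−1}(k−1)!·k!)) · p^k · δ(a)^k · a^{−pk} converges in ℚ_p, and the Legendre symbol of the reduction of a modulo p, viewed as an element of ℤ_p via the map {−1, 0, 1} → ℤ_p, equals a^{(p−1)/2} · ( 1 + ∑_{k=1}^∞ (−1)^{k−1} ((2k−2)! / (2^{2k−1}(k−1)!·k!)) · p^k · δ(a)^k · a^{−pk} ). -/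
/-- The term of index `k = j + 1 ≥ 1` of Buium's series for the quadratic residue symbol:
`(-1)^{k-1} ((2k-2)!/(2^{2k-1}(k-1)!k!)) · p^k · δ(a)^k · a^{-pk}`, where
`δ(a) = (a - a^p)/p` for a `p`-adic unit `a`. -/
noncomputable def quadResidueSeriesTerm (p : ℕ) [Fact p.Prime] (u : ℤ_[p]ˣ) (j : ℕ) : ℚ_[p] :=
  (-1 : ℚ_[p]) ^ j *
    (((2 * j).factorial / (2 ^ (2 * j + 1) * j.factorial * (j + 1).factorial) : ℚ) : ℚ_[p]) *
    (p : ℚ_[p]) ^ (j + 1) *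
    ((((u : ℤ_[p]) : ℚ_[p]) - ((u : ℤ_[p]) : ℚ_[p]) ^ p) / (p : ℚ_[p])) ^ (j + 1) *
    (((u : ℤ_[p]) : ℚ_[p]) ^ (p * (j + 1)))⁻¹

/-- The generating function of the Catalan numbers satisfies `c = 1 + t c ^ 2` wherever it
converges absolutely. -/
theorem tsum_catalan_mul_pow_eq {K : Type*} [NormedField K] [CompleteSpace K] {t : K}
    (h : Summable fun n : ℕ ↦ ‖(catalan n : K) * t ^ n‖) :
    ∑' n : ℕ, (catalan n : K) * t ^ n = 1 + t * (∑' n : ℕ, (catalan n : K) * t ^ n) ^ 2 := by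
  rw [sq, tsum_mul_tsum_eq_tsum_sum_antidiagonal_of_summable_norm h h, ← tsum_mul_left,
    h.of_norm.tsum_eq_zero_add]
  congr 1
  · simp
  · refine tsum_congr fun n ↦ ?_
    rw [catalan_succ', Nat.cast_sum, Finset.sum_mul, Finset.mul_sum]
    refine Finset.sum_congr rfl fun ij hij ↦ ?_
    rw [← Finset.HasAntidiagonal.mem_antidiagonal.1 hij]
    push_cast
    ring

theorem factorial_div_eq_catalan_div (j : ℕ) :
    ((2 * j).factorial / (2 ^ (2 * j + 1) * j.factorial * (j + 1).factorial) : ℚ) =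
      catalan j / 2 ^ (2 * j + 1) := by
  have h : ((j + 1 : ℕ) : ℚ) * catalan j = (2 * j).choose j := by
    exact_mod_cast succ_mul_catalan_eq_centralBinom j
  have h' : ((2 * j).choose j * j.factorial * j.factorial : ℚ) = (2 * j).factorial := by
    have := Nat.choose_mul_factorial_mul_factorial (show j ≤ 2 * j by lia)
    rw [show 2 * j - j = j by lia] at this
    exact_mod_cast this
  have := j.factorial_pos
  rw [← h', ← h, Nat.factorial_succ]
  push_cast
  field_simp

namespace Padic

variable {p : ℕ} [Fact p.Prime]

theorem norm_two_of_ne_two (hp : p ≠ 2) : ‖(2 : ℚ_[p])‖ = 1 := by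
  have h : Nat.Coprime p 2 :=
    (Nat.coprime_primes Fact.out Nat.prime_two).2 hp
  exact_mod_cast Padic.norm_natCast_eq_one_iff.2 h

theorem summable_norm_catalan_mul_pow {t : ℚ_[p]} (ht : ‖t‖ < 1) :
    Summable fun n : ℕ ↦ ‖(catalan n : ℚ_[p]) * t ^ n‖ := by
  refine (summable_geometric_of_lt_one (norm_nonneg t) ht).of_nonneg_of_le
    (fun _ ↦ norm_nonneg _) fun n ↦ ?_
  rw [norm_mul, norm_pow]
  exact mul_le_of_le_one_left (by positivity) (by exact_mod_cast Padic.norm_int_le_one (catalan n))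

theorem norm_tsum_catalan_mul_pow_le_one {t : ℚ_[p]} (ht : ‖t‖ < 1) :
    ‖∑' n : ℕ, (catalan n : ℚ_[p]) * t ^ n‖ ≤ 1 := by
  refine IsUltrametricDist.norm_tsum_le_of_forall_le_of_nonneg zero_le_one fun n ↦ ?_
  rw [norm_mul, norm_pow]
  exact mul_le_one₀ (by exact_mod_cast Padic.norm_int_le_one (catalan n)) (by positivity)
    (pow_le_one₀ (norm_nonneg t) ht.le)

theorem eq_of_sq_eq_one_of_norm_sub_lt_one (hp : p ≠ 2) {x y : ℚ_[p]} (hx : x ^ 2 = 1)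
    (hy : y ^ 2 = 1) (h : ‖x - y‖ < 1) : x = y := by
  have h2 := norm_two_of_ne_two hp
  rcases sq_eq_one_iff.1 hx with rfl | rfl <;>
    rcases sq_eq_one_iff.1 hy with rfl | rfl
  · rfl
  · norm_num [h2] at h
  · norm_num [h2] at h
  · rfl

end Padic

theorem PadicInt.norm_lt_one_of_toZMod_eq_zero {p : ℕ} [Fact p.Prime] {x : ℤ_[p]}
    (h : PadicInt.toZMod x = 0) : ‖x‖ < 1 := by
  rw [← RingHom.mem_ker, PadicInt.ker_toZMod] at h
  exact PadicInt.mem_nonunits.1 h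

theorem quadResidueSeriesTerm_eq (p : ℕ) [Fact p.Prime] (u : ℤ_[p]ˣ) (j : ℕ) :
    quadResidueSeriesTerm p u j =
      -2 * (-((u : ℚ_[p]) - (u : ℚ_[p]) ^ p) / (u : ℚ_[p]) ^ p / 4) *
        (catalan j * (-((u : ℚ_[p]) - (u : ℚ_[p]) ^ p) / (u : ℚ_[p]) ^ p / 4) ^ j) := by
  have hp : (p : ℚ_[p]) ≠ 0 := by exact_mod_cast (Fact.out : p.Prime).ne_zero
  rw [quadResidueSeriesTerm, factorial_div_eq_catalan_div, pow_mul (u : ℚ_[p]), ← inv_pow]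
  generalize (u : ℚ_[p]) - (u : ℚ_[p]) ^ p = d
  generalize (u : ℚ_[p]) ^ p = e
  push_cast
  rw [div_pow, mul_assoc _ ((p : ℚ_[p]) ^ (j + 1)), mul_div_cancel₀ _ (pow_ne_zero _ hp),
    show (2 : ℚ_[p]) ^ (2 * j + 1) = 2 * 4 ^ j by rw [pow_succ, pow_mul]; norm_num; ring,
    show -d / e / 4 = (-1) * d * e⁻¹ * 4⁻¹ by ring]
  simp only [mul_pow, inv_pow, pow_succ, div_eq_mul_inv, mul_inv]
  rw [show (4 : ℚ_[p])⁻¹ = 2⁻¹ * 2⁻¹ by norm_num]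
  field_simp

/-- For an odd prime `p` and a `p`-adic unit `a`, Buium's series for the quadratic residue
symbol converges, and the Legendre symbol of `a mod p` equals
`a^{(p-1)/2} · (1 + ∑_{k≥1} (-1)^{k-1} ((2k-2)!/(2^{2k-1}(k-1)!k!)) p^k δ(a)^k a^{-pk})`. -/
theorem legendre_symbol_series (p : ℕ) [Fact p.Prime] (hp : p ≠ 2) (u : ℤ_[p]ˣ) :
    Summable (quadResidueSeriesTerm p u) ∧
      ((quadraticChar (ZMod p) (PadicInt.toZMod (u : ℤ_[p])) : ℤ) : ℚ_[p]) =
        ((u : ℤ_[p]) : ℚ_[p]) ^ ((p - 1) / 2) *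
          (1 + ∑' j : ℕ, quadResidueSeriesTerm p u j) := by
  set a : ℚ_[p] := ((u : ℤ_[p]) : ℚ_[p]) with ha
  have hodd : p % 2 = 1 := (Fact.out : p.Prime).eq_two_or_odd.resolve_left hp
  have ha1 : ‖a‖ = 1 := PadicInt.norm_units u
  have ha0 : a ≠ 0 := norm_ne_zero_iff.1 (by simp [ha1])
  have h2 := Padic.norm_two_of_ne_two hp
  have h4 : ‖(4 : ℚ_[p])‖ = 1 := by
    rw [show (4 : ℚ_[p]) = 2 * 2 by norm_num, norm_mul, h2, one_mul]
  have hd : ‖a - a ^ p‖ < 1 := by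
    have : ‖(u : ℤ_[p]) - (u : ℤ_[p]) ^ p‖ < 1 :=
      PadicInt.norm_lt_one_of_toZMod_eq_zero (by rw [map_sub, map_pow, ZMod.pow_card, sub_self])
    simpa [PadicInt.norm_def] using this
  set t : ℚ_[p] := -(a - a ^ p) / a ^ p / 4 with ht
  have htn : ‖t‖ < 1 := by
    rwa [ht, norm_div, norm_div, norm_neg, norm_pow, ha1, h4, one_pow, div_one, div_one]
  have hterm : quadResidueSeriesTerm p u = fun j ↦ -2 * t * (catalan j * t ^ j) :=
    funext (quadResidueSeriesTerm_eq p u)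
  have hsum := Padic.summable_norm_catalan_mul_pow htn
  refine ⟨hterm ▸ hsum.of_norm.mul_left _, ?_⟩
  have hc := tsum_catalan_mul_pow_eq hsum
  have hcn := Padic.norm_tsum_catalan_mul_pow_le_one htn
  rw [hterm, tsum_mul_left]
  set c : ℚ_[p] := ∑' n : ℕ, (catalan n : ℚ_[p]) * t ^ n
  have hu : PadicInt.toZMod (u : ℤ_[p]) ≠ 0 := (u.isUnit.map PadicInt.toZMod).ne_zero
  refine Padic.eq_of_sq_eq_one_of_norm_sub_lt_one hp ?_ ?_ ?_
  · exact_mod_cast quadraticChar_sq_one hu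
  · have hsq : (1 + -2 * t * c) ^ 2 = a / a ^ p := by
      have : (1 + -2 * t * c) ^ 2 = 1 - 4 * t := by linear_combination -4 * t * hc
      rw [this, ht]
      field_simp
      ring
    rw [mul_pow, hsq, ← pow_mul, show (p - 1) / 2 * 2 = p - 1 by lia, mul_div_assoc', ← pow_succ,
      show p - 1 + 1 = p by lia, div_self (pow_ne_zero _ ha0)]
  · set q : ℤ := quadraticChar (ZMod p) (PadicInt.toZMod (u : ℤ_[p])) with hq
    have h1 : ‖(q : ℚ_[p]) - a ^ ((p - 1) / 2)‖ < 1 := by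
      have : ‖(q : ℤ_[p]) - (u : ℤ_[p]) ^ ((p - 1) / 2)‖ < 1 := by
        refine PadicInt.norm_lt_one_of_toZMod_eq_zero ?_
        rw [map_sub, map_pow, map_intCast, hq, quadraticChar_eq_pow_of_char_ne_two'
          (by rwa [ZMod.ringChar_zmod_n]), ZMod.card, show p / 2 = (p - 1) / 2 by lia, sub_self]
      simpa [PadicInt.norm_def] using this
    have h3 : ‖a ^ ((p - 1) / 2) * (2 * t * c)‖ < 1 := by
      rw [norm_mul, norm_mul, norm_mul, norm_pow, ha1, h2, one_pow, one_mul, one_mul]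
      exact mul_lt_one_of_nonneg_of_lt_one_left (norm_nonneg t) htn hcn
    rw [show (q : ℚ_[p]) - a ^ ((p - 1) / 2) * (1 + -2 * t * c) =
      (q - a ^ ((p - 1) / 2)) + a ^ ((p - 1) / 2) * (2 * t * c) by ring]
    exact (IsUltrametricDist.norm_add_le_max _ _).trans_lt (max_lt h1 h3)
end

section
/- (Kapranov–Smirnov: the power residue symbol as a determinant over F_{1^n}.) Let F be a finite field with q elements, let n ≥ 1 divide q − 1, and let H := {x ∈ F^× : x^n = 1} be the subgroup of n-th roots of unity of F^× (of order n). Let S ⊆ F^× be a set of representatives for the cosets of H in F^× (S contains exactly one element of each coset, so |S| = (q−1)/n). For a ∈ F^×, let σ_a : S → S be the map sending s ∈ S to the unique element of S lying in the coset a·s·H. Then σ_a is a bijection of S, and ∏_{s ∈ S} ( a·s·σ_a(s)^{−1} ) = a^{(q−1)/n}; in particular this product lies in H and equals the n-th power residue symbol of a. -/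
/-- A finite set of representatives for the cosets of the `n`-torsion of a finite cyclic group `G`,
where `n` divides the order of `G`, has `|G| / n` elements. -/
theorem card_torsion_coset_representatives {G : Type*} [CommGroup G] [Finite G] [IsCyclic G]
    {n : ℕ} (hn : 1 ≤ n) (hdvd : n ∣ Nat.card G) (S : Finset G)
    (hS : ∀ x : G, ∃! s : G, s ∈ S ∧ ∃ h : G, h ^ n = 1 ∧ x = s * h) :
    S.card = Nat.card G / n := by
  have hH : Nat.card (powMonoidHom n : G →* G).ker = n := by
    rw [IsCyclic.card_powMonoidHom_ker, Nat.gcd_eq_right hdvd]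
  have hbij : Function.Bijective
      (fun p : S × (powMonoidHom n : G →* G).ker => (p.1 : G) * (p.2 : G)) := by
    constructor
    · rintro ⟨⟨s, hs⟩, ⟨h, hh⟩⟩ ⟨⟨t, ht⟩, ⟨k, hk⟩⟩ heq
      simp only [MonoidHom.mem_ker, powMonoidHom_apply] at hh hk heq
      obtain rfl : s = t := (hS (s * h)).unique ⟨hs, h, hh, rfl⟩ ⟨ht, k, hk, heq⟩
      obtain rfl : h = k := mul_left_cancel heq
      rfl
    · intro x
      obtain ⟨s, ⟨hs, h, hh, rfl⟩, -⟩ := hS x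
      exact ⟨⟨⟨s, hs⟩, ⟨h, hh⟩⟩, rfl⟩
  have hcard := Nat.card_eq_of_bijective _ hbij
  rw [Nat.card_prod, hH, Nat.card_eq_fintype_card, Fintype.card_coe] at hcard
  rw [← hcard, Nat.mul_div_cancel _ hn]


/-- Kapranov–Smirnov: the power residue symbol as a determinant over `F_{1^n}`.
Let `F` be a finite field with `q` elements, `n ∣ q - 1`, `H = {h : h^n = 1} ≤ F^×`,
and let `S` be a set of coset representatives of `H` in `F^×`.  For `a ∈ F^×`, let
`σ : S → S` send `s` to the representative of the coset `a·s·H`.  Then `σ` is a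
bijection of `S` and `∏_{s ∈ S} a·s·σ(s)⁻¹ = a^{(q-1)/n}`; in particular this
product lies in `H` (it is the `n`-th power residue symbol of `a`). -/
theorem kapranov_smirnov_power_residue (F : Type*) [Field F] [Fintype F]
    (n : ℕ) (hn : 1 ≤ n) (hdvd : n ∣ Fintype.card F - 1)
    (S : Finset Fˣ)
    (hS : ∀ x : Fˣ, ∃! s : Fˣ, s ∈ S ∧ ∃ h : Fˣ, h ^ n = 1 ∧ x = s * h)
    (a : Fˣ) (σ : Fˣ → Fˣ)
    (hσ : ∀ s ∈ S, σ s ∈ S ∧ ∃ h : Fˣ, h ^ n = 1 ∧ a * s = σ s * h) :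
    Set.BijOn σ ↑S ↑S ∧
      (∏ s ∈ S, (a * s * (σ s)⁻¹)) = a ^ ((Fintype.card F - 1) / n) ∧
      (∏ s ∈ S, (a * s * (σ s)⁻¹)) ^ n = 1 := by
  have hinj : Set.InjOn σ ↑S := by
    intro s hs t ht hst
    obtain ⟨-, h, hh, hsh⟩ := hσ s hs
    obtain ⟨-, k, hk, htk⟩ := hσ t ht
    refine (hS s).unique ⟨hs, 1, one_pow n, (mul_one s).symm⟩
      ⟨ht, h * k⁻¹, by rw [mul_pow, inv_pow, hh, hk, inv_one, mul_one], ?_⟩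
    rw [← hst] at htk
    apply mul_left_cancel (a := a)
    rw [← mul_assoc, htk, hsh]
    rw [mul_assoc, mul_comm h, mul_inv_cancel_left]
  have hmaps : Set.MapsTo σ ↑S ↑S := fun s hs => (hσ s hs).1
  have hbij : Set.BijOn σ ↑S ↑S :=
    ⟨hmaps, hinj, Finset.surjOn_of_injOn_of_card_le σ hmaps hinj le_rfl⟩
  have hunits : Nat.card Fˣ = Fintype.card F - 1 := by
    rw [Nat.card_units, Nat.card_eq_fintype_card]
  have hcard : S.card = (Fintype.card F - 1) / n := by
    rw [← hunits] at hdvd ⊢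
    exact card_torsion_coset_representatives hn hdvd S hS
  have hprod : ∏ s ∈ S, σ s = ∏ s ∈ S, s :=
    Finset.prod_nbij σ hmaps hinj hbij.surjOn fun _ _ => rfl
  refine ⟨hbij, ?_, ?_⟩
  · rw [Finset.prod_mul_distrib, Finset.prod_mul_distrib, Finset.prod_const,
      Finset.prod_inv_distrib, hprod, mul_inv_cancel_right, hcard]
  · rw [← Finset.prod_pow]
    refine Finset.prod_eq_one fun s hs => ?_
    obtain ⟨-, h, hh, hsh⟩ := hσ s hs
    rw [hsh, mul_comm (σ s), mul_inv_cancel_right, hh]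
end
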